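/- Two-point Nevanlinna–Pick interpolation with a real node: let r ∈ (−1,1) ⊂ ℝ, let p ∈ 𝔹 with p ≠ r, and let s, q ∈ 𝔹. Then there exists a slice regular self-map f of 𝔹 with f(r) = s and f(p) = q if and only if ρ(q, s) ≤ ρ(p, r). -/

import Mathlib

noncomputable section

abbrev H : Type := Quaternion ℝ

namespace QPaper

/-- The complex slice determined by `I`: the real span of `1` and `I`. -/
def sliceSet (I : H) : Set H := {q | ∃ x y : ℝ, q = (x : H) + y • I}

/-- Evaluation of the power series `q ↦ ∑ qᵐ aₘ` with right coefficients. -/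
def evalC (a : ℕ → H) (q : H) : H := ∑' m, q ^ m * a m

/-- The series with coefficients `a` converges at every point of the unit ball. -/
def SummableOn (a : ℕ → H) : Prop := ∀ q : H, ‖q‖ < 1 → Summable fun m => q ^ m * a m

/-- `a` are the coefficients of a slice regular self-map of the unit ball. -/
def SelfMap (a : ℕ → H) : Prop :=
  SummableOn a ∧ ∀ q : H, ‖q‖ < 1 → ‖evalC a q‖ < 1

/-- Coefficients of the ∗-product. -/
def starMulC (a b : ℕ → H) : ℕ → H := fun m => ∑ ℓ ∈ Finset.range (m + 1), a (m - ℓ) * b ℓ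

/-- Coefficients of the ∗-inverse (of a series with invertible constant term). -/
def starInvC (a : ℕ → H) : ℕ → H
  | 0 => (a 0)⁻¹
  | m + 1 => -(a 0)⁻¹ * ∑ ℓ : Fin (m + 1), a (m + 1 - ℓ.val) * starInvC a ℓ.val
  decreasing_by exact ℓ.isLt

/-- Coefficients of `1 - q p̄`. -/
def oneMinusQPbarC (p : H) : ℕ → H := fun m => if m = 0 then 1 else if m = 1 then -(star p) else 0

/-- Coefficients of `q - p`. -/
def qMinusPC (p : H) : ℕ → H := fun m => if m = 0 then -p else if m = 1 then 1 else 0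

/-- Coefficients of the regular Möbius transformation `ℳ_p = (1 - q p̄)^{-∗} ∗ (q - p)`. -/
def mobiusC (p : H) : ℕ → H := starMulC (starInvC (oneMinusQPbarC p)) (qMinusPC p)

/-- Coefficients of `ℳ_{t₁} ∗ ⋯ ∗ ℳ_{t_κ}`. -/
def blaschkeListC : List H → (ℕ → H)
  | [] => fun m => if m = 0 then 1 else 0
  | t :: ts => starMulC (mobiusC t) (blaschkeListC ts)

/-- `a` are the coefficients of a regular Blaschke product of degree `κ`,
i.e. of `ℳ_{t₁} ∗ ⋯ ∗ ℳ_{t_κ} u` with the `tᵢ` in `𝔹` and `u` unimodular. -/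
def IsBlaschke (a : ℕ → H) (κ : ℕ) : Prop :=
  ∃ (ts : List H) (u : H), ts.length = κ ∧ (∀ t ∈ ts, ‖t‖ < 1) ∧ ‖u‖ = 1 ∧
    a = fun m => blaschkeListC ts m * u

/-- Coefficients of `ℳ_w ∙ f = (1 - f w̄)^{-∗} ∗ (f - w)`. -/
def bulletC (w : H) (a : ℕ → H) : ℕ → H :=
  starMulC (starInvC (fun m => (if m = 0 then (1 : H) else 0) - a m * star w))
    (fun m => a m - if m = 0 then w else 0)

/-- Coefficients of the regular difference quotient `ℛ_{f,p}`,
the unique slice regular function with `f(q) = f(p) + (q - p) ∗ ℛ_{f,p}(q)`. -/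
def diffQuotC (a : ℕ → H) (p : H) : ℕ → H := fun m => ∑' k, p ^ k * a (k + m + 1)

/-- Coefficients of the hyperbolic difference quotient
`f⋆_p = (1 - q p̄) ∗ ℛ_{f,p} ∗ (1 - \overline{f(p)} f)^{-∗} = ℳ_p^{-∗} ∗ (ℳ_{f(p)} ∙ f)`. -/
def hdqC (a : ℕ → H) (p : H) : ℕ → H :=
  starMulC (starMulC (oneMinusQPbarC p) (diffQuotC a p))
    (starInvC (fun m => (if m = 0 then (1 : H) else 0) - star (evalC a p) * a m))

/-- Iterated hyperbolic difference quotients: `ihdqC a [p₁, …, pₙ] = ((f⋆_{p₁})⋆_{p₂} ⋯)⋆_{pₙ}`. -/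
def ihdqC (a : ℕ → H) : List H → (ℕ → H)
  | [] => a
  | p :: ps => ihdqC (hdqC a p) ps

/-- `𝒯_p(q) = (1 - q p)⁻¹ q (1 - q p)`. -/
def mobiusT (p q : H) : H := (1 - q * p)⁻¹ * q * (1 - q * p)

/-- `M_p(q) = (1 - q p̄)⁻¹ (q - p)`. -/
def mobiusM (p q : H) : H := (1 - q * star p)⁻¹ * (q - p)

/-- Pointwise evaluation of the regular Möbius transformation: `ℳ_p(q) = M_p(𝒯_p(q))`. -/
def mobiusEval (p q : H) : H := mobiusM p (mobiusT p q)

/-- The pseudo-hyperbolic distance `ρ(p,q) = |M_p(q)|`. -/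
def rho (p q : H) : ℝ := ‖mobiusM p q‖

/-- The Poincaré distance `δ(p,q) = tanh⁻¹ ρ(p,q) = ½ log((1+ρ)/(1−ρ))`. -/
def pdist (p q : H) : ℝ := (1/2 : ℝ) * Real.log ((1 + rho p q) / (1 - rho p q))


lemma key_normSq (A B s : H) :
    Quaternion.normSq (B + A * s) = Quaternion.normSq (A + B * star s)
      - (1 - Quaternion.normSq s) * (Quaternion.normSq A - Quaternion.normSq B) := by
  simp only [Quaternion.normSq_def', Quaternion.re_add, Quaternion.imI_add, Quaternion.imJ_add,
    Quaternion.imK_add, Quaternion.re_mul, Quaternion.imI_mul, Quaternion.imJ_mul,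
    Quaternion.imK_mul, Quaternion.re_star, Quaternion.imI_star, Quaternion.imJ_star,
    Quaternion.imK_star]
  ring

lemma key_norm_lt {A B s : H} (hs : ‖s‖ < 1) (h : ‖B‖ < ‖A‖) :
    ‖B + A * s‖ < ‖A + B * star s‖ := by
  have h1 := key_normSq A B s
  simp only [Quaternion.normSq_eq_norm_mul_self] at h1
  have h2 : 0 < (1 - ‖s‖ * ‖s‖) * (‖A‖ * ‖A‖ - ‖B‖ * ‖B‖) := by
    apply mul_pos <;> nlinarith [norm_nonneg s, norm_nonneg A, norm_nonneg B]
  nlinarith [norm_nonneg (B + A * s), norm_nonneg (A + B * star s)]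

lemma mob_lt {r : ℝ} (hr1 : -1 < r) (hr2 : r < 1) {x : H} (hx : ‖x‖ < 1) :
    ‖x - (r : H)‖ < ‖1 - (r : H) * x‖ := by
  have h := key_norm_lt (A := 1) (B := -(r : H)) (s := x) hx (by
    rw [norm_neg, Quaternion.norm_coe, norm_one, Real.norm_eq_abs, abs_lt]; exact ⟨hr1, hr2⟩)
  have h2 : ‖1 + -(r : H) * star x‖ = ‖1 - (r : H) * x‖ := by
    rw [← norm_star, star_add, star_mul, star_star, star_one, star_neg, Quaternion.star_coe,
      mul_neg, ← sub_eq_add_neg, Quaternion.coe_commutes]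
  rw [h2] at h
  simpa [add_comm, sub_eq_add_neg] using h

/-- coefficients of the interpolant -/
def intC (r : ℝ) (s c w v : H) (N : ℝ) (n : ℕ) : H :=
  (if n = 0 then s else N • ((-w) ^ (n - 1) * v * c)) - (r * N) • ((-w) ^ n * v * c)

lemma back_main {r : ℝ} (hr1 : -1 < r) (hr2 : r < 1) {s c : H} (hs : ‖s‖ < 1) (hc : ‖c‖ ≤ 1) :
    ∃ a : ℕ → H, ∀ x : H, ‖x‖ < 1 → (Summable fun m => x ^ m * a m) ∧
      ∃ Y : H, (1 - (r : H) * x) * Y + (x - (r : H)) * Y * (c * star s) = 1 ∧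
        evalC a x = s + (1 - ‖s‖ * ‖s‖) • ((x - (r : H)) * Y * c) := by
  set e : H := c * star s with he
  have hen : ‖e‖ < 1 := by
    rw [he, norm_mul, norm_star]
    nlinarith [norm_nonneg c, norm_nonneg s]
  have hm := mob_lt hr1 hr2 hen
  have hv0 : (1 - (r : H) * e) ≠ 0 := by
    intro h; rw [h, norm_zero] at hm; exact absurd hm (not_lt.mpr (norm_nonneg _))
  set v : H := (1 - (r : H) * e)⁻¹ with hv
  set w : H := v * (e - (r : H)) with hw
  have hwn : ‖w‖ < 1 := by
    rw [hw, hv, norm_mul, norm_inv, inv_mul_lt_iff₀ (norm_pos_iff.mpr hv0), mul_one]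
    exact hm
  set N : ℝ := 1 - ‖s‖ * ‖s‖ with hN
  refine ⟨intC r s c w v N, fun x hx => ?_⟩
  have hxw : ‖x‖ * ‖w‖ < 1 := by nlinarith [norm_nonneg x, norm_nonneg w]
  have hsum : Summable fun n : ℕ => x ^ n * (-w) ^ n := by
    refine Summable.of_norm_bounded (g := fun n : ℕ => (‖x‖ * ‖w‖) ^ n)
      (summable_geometric_of_lt_one (by positivity) hxw) (fun n => ?_)
    rw [norm_mul, norm_pow, norm_pow, norm_neg, mul_pow]
  obtain ⟨Z, hZ⟩ := hsum
  have hZ1 : HasSum (fun n : ℕ => x ^ (n + 1) * (-w) ^ (n + 1)) (x * Z * (-w)) := by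
    have := (hZ.mul_left x).mul_right (-w)
    have hfe : (fun n : ℕ => x ^ (n + 1) * (-w) ^ (n + 1)) =
        fun n : ℕ => x * (x ^ n * (-w) ^ n) * (-w) := by
      funext n
      rw [pow_succ' x, pow_succ (-w)]
      simp only [mul_assoc]
    rw [hfe]
    exact this
  have hZe : Z = 1 + x * Z * (-w) := by
    have := (hasSum_nat_add_iff (f := fun n : ℕ => x ^ n * (-w) ^ n) 1).mp hZ1
    have := hZ.unique this
    simpa [add_comm] using this
  have hA : HasSum (fun n : ℕ => x ^ n * ((-w) ^ n * v * c)) (Z * v * c) := by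
    have := (hZ.mul_right v).mul_right c
    simpa only [mul_assoc] using this
  have hB : HasSum (fun n : ℕ => x ^ n * (if n = 0 then s else N • ((-w) ^ (n - 1) * v * c)))
      (s + N • (x * Z * v * c)) := by
    have h1 : HasSum (fun n : ℕ => x ^ (n + 1) *
        (if n + 1 = 0 then s else N • ((-w) ^ (n + 1 - 1) * v * c))) (N • (x * Z * v * c)) := by
      have := (hA.mul_left x).const_smul N
      simpa [pow_succ', mul_assoc] using this
    have := (hasSum_nat_add_iff (f := fun n : ℕ => x ^ n *
      (if n = 0 then s else N • ((-w) ^ (n - 1) * v * c))) 1).mp h1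
    simpa [add_comm] using this
  have hT : HasSum (fun n : ℕ => x ^ n * intC r s c w v N n)
      (s + N • (x * Z * v * c) - (r * N) • (Z * v * c)) := by
    have := hB.sub (hA.const_smul (r * N))
    simpa [intC, mul_sub] using this
  refine ⟨hT.summable, Z * v, ?_, ?_⟩
  · have hce : Commute e v := by
      rw [hv]
      apply Commute.inv_right₀
      apply Commute.sub_right (Commute.one_right _)
      exact Commute.mul_right (Quaternion.coe_commutes r e).symm (Commute.refl e)
    have h1 : v * (1 - (r : H) * e) = 1 := inv_mul_cancel₀ hv0
    have h2 : v * e = e * v := hce.symm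
    have hcr : ∀ y : H, (r : H) * y = y * (r : H) := Quaternion.coe_commutes r
    have h3 : w = (e - (r : H)) * v := by
      rw [hw, mul_sub, sub_mul, h2, hcr v]
    have e1 : (1 - (r : H) * x) * (Z * v) + (x - (r : H)) * (Z * v) * e
        = Z * (v * (1 - (r : H) * e)) + x * Z * (v * (e - (r : H))) := by
      simp only [sub_mul, mul_sub, Quaternion.coe_mul_eq_smul, Quaternion.mul_coe_eq_smul,
        smul_mul_assoc, mul_smul_comm, one_mul, mul_one, mul_assoc]
      abel
    rw [e1, h1, ← hw, mul_one]
    nth_rewrite 1 [hZe]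
    rw [mul_neg]; abel
  · show (∑' m, _) = _
    rw [hT.tsum_eq, sub_mul, sub_mul, smul_sub, mul_comm r N, mul_smul]
    have : (r : H) * (Z * v) * c = r • (Z * v * c) := by
      rw [Quaternion.coe_mul_eq_smul, smul_mul_assoc]
    rw [this, ← mul_assoc x Z v]
    abel

lemma back {r : ℝ} (hr1 : -1 < r) (hr2 : r < 1)
    {p : H} (hp : ‖p‖ < 1) (hpr : p ≠ (r : H)) {s q : H} (hs : ‖s‖ < 1) (hq : ‖q‖ < 1)
    (h : ‖q - s‖ * ‖1 - (r : H) * p‖ ≤ ‖1 - q * star s‖ * ‖p - (r : H)‖) :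
    ∃ a : ℕ → H, SelfMap a ∧ evalC a (r : H) = s ∧ evalC a p = q := by
  have h1 : 1 - q * star s ≠ 0 := by
    intro h0
    have : ‖q * star s‖ = 1 := by rw [← sub_eq_zero.mp h0, norm_one]
    rw [norm_mul, norm_star] at this
    nlinarith [norm_nonneg q, norm_nonneg s]
  have h2 : p - (r : H) ≠ 0 := sub_ne_zero.mpr hpr
  have hm := mob_lt hr1 hr2 hp
  have h3 : (1 - (r : H) * p) ≠ 0 := by
    intro h; rw [h, norm_zero] at hm; exact absurd hm (not_lt.mpr (norm_nonneg _))
  have hN : 0 < 1 - ‖s‖ * ‖s‖ := by nlinarith [norm_nonneg s]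
  set c : H := (1 - q * star s)⁻¹ * ((p - (r : H))⁻¹ * ((1 - (r : H) * p) * (q - s))) with hc
  have hcn : ‖c‖ ≤ 1 := by
    rw [hc, norm_mul, norm_mul, norm_mul, norm_inv, norm_inv,
      inv_mul_le_iff₀ (norm_pos_iff.mpr h1), inv_mul_le_iff₀ (norm_pos_iff.mpr h2)]
    linarith
  have hen : ‖c * star s‖ < 1 := by
    rw [norm_mul, norm_star]
    nlinarith [norm_nonneg c, norm_nonneg s]
  obtain ⟨a, ha⟩ := back_main hr1 hr2 hs hcn
  refine ⟨a, ⟨fun x hx => (ha x hx).1, fun x hx => ?_⟩, ?_, ?_⟩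
  · obtain ⟨-, Y, hY, hE⟩ := ha x hx
    have hmx := mob_lt hr1 hr2 hx
    have hY0 : Y ≠ 0 := by rintro rfl; simp at hY
    have hk := key_norm_lt (A := (1 - (r : H) * x) * Y) (B := (x - (r : H)) * Y * c) hs (by
      rw [norm_mul _ c, norm_mul _ Y, norm_mul _ Y]
      have h0 := norm_pos_iff.mpr hY0
      have h7 : ‖x - (r : H)‖ * ‖Y‖ * ‖c‖ ≤ ‖x - (r : H)‖ * ‖Y‖ * 1 := by gcongr
      have h8 := mul_lt_mul_of_pos_right hmx h0
      linarith)
    rw [mul_assoc _ c, hY, norm_one] at hk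
    rw [hE]
    convert hk using 2
    rw [eq_sub_of_add_eq hY, ← mul_assoc _ c, sub_mul 1, one_mul, mul_assoc _ (star s),
      Quaternion.star_mul_self, Quaternion.normSq_eq_norm_mul_self, Quaternion.mul_coe_eq_smul,
      sub_smul, one_smul]
    abel
  · obtain ⟨-, Y, hY, hE⟩ := ha (r : H) (by
      rw [Quaternion.norm_coe, Real.norm_eq_abs, abs_lt]; exact ⟨hr1, hr2⟩)
    rw [hE]; simp
  · obtain ⟨-, Y, hY, hE⟩ := ha p hp
    set N : ℝ := 1 - ‖s‖ * ‖s‖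
    set Y' : H := N⁻¹ • ((1 - (r : H) * p)⁻¹ * (1 - q * star s)) with hY'
    have hcomm : (p - (r : H)) * (1 - (r : H) * p)⁻¹ * (p - (r : H))⁻¹ = (1 - (r : H) * p)⁻¹ := by
      have : Commute (p - (r : H)) (1 - (r : H) * p)⁻¹ := by
        apply Commute.inv_right₀
        have hrr : Commute p (r : H) := (Quaternion.coe_commutes r p).symm
        apply Commute.sub_left
        · exact (Commute.one_right _).sub_right (hrr.mul_right (Commute.refl p))
        · exact (Commute.one_right _).sub_right ((Commute.refl _).mul_right hrr.symm)
      rw [this.eq, mul_assoc, mul_inv_cancel₀ h2, mul_one]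
    have hX : (p - (r : H)) * Y' * c = N⁻¹ • (q - s) := by
      rw [hY', mul_smul_comm, smul_mul_assoc, hc]
      congr 1
      calc _ = ((p - (r : H)) * (1 - (r : H) * p)⁻¹ *
            ((1 - q * star s) * (1 - q * star s)⁻¹) * (p - (r : H))⁻¹) *
              (1 - (r : H) * p) * (q - s) := by simp only [mul_assoc]
        _ = _ := by rw [mul_inv_cancel₀ h1, mul_one, hcomm, inv_mul_cancel₀ h3, one_mul]
    have hYY : (1 - (r : H) * p) * Y' + (p - (r : H)) * Y' * (c * star s) = 1 := by
      rw [← mul_assoc, hX, hY', mul_smul_comm, mul_inv_cancel_left₀ h3, smul_mul_assoc, ← smul_add,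
        inv_smul_eq_iff₀ hN.ne', sub_mul, Quaternion.self_mul_star,
        Quaternion.normSq_eq_norm_mul_self, sub_smul, one_smul,
        ← Quaternion.coe_mul_eq_smul (‖s‖ * ‖s‖), mul_one]
      abel
    have hD : (1 - (r : H) * p) * (Y - Y') = -((p - (r : H)) * (Y - Y') * (c * star s)) := by
      rw [mul_sub, mul_sub, sub_mul (_ * Y), eq_sub_of_add_eq hY, eq_sub_of_add_eq hYY]
      abel
    have hYeq : Y = Y' := by
      by_contra hne
      have hp0 := norm_pos_iff.mpr (sub_ne_zero.mpr hne)
      have := congrArg norm hD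
      rw [norm_neg, norm_mul, norm_mul, norm_mul] at this
      have h5 : ‖p - (r : H)‖ * ‖Y - Y'‖ * ‖c * star s‖ ≤ ‖p - (r : H)‖ * ‖Y - Y'‖ * 1 := by gcongr
      nlinarith
    rw [hE, hYeq, hX, smul_inv_smul₀ hN.ne']
    abel

lemma norm_coeComplex' (z : ℂ) : ‖(z : H)‖ = ‖z‖ := by
  have h : ‖(z : H)‖ ^ 2 = ‖z‖ ^ 2 := by
    rw [sq, ← Quaternion.normSq_eq_norm_mul_self, Quaternion.normSq_def', Complex.sq_norm,
      Complex.normSq_apply]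
    simp
    ring
  exact (pow_left_inj₀ (norm_nonneg _) (norm_nonneg _) two_ne_zero).mp h

lemma exists_conj (p : H) : ∃ (h : H) (z : ℂ), h ≠ 0 ∧ h * p = (z : H) * h := by
  by_cases hp : p.imJ = 0 ∧ p.imK = 0
  · refine ⟨1, ⟨p.re, p.imI⟩, one_ne_zero, ?_⟩
    ext <;> simp [hp.1, hp.2]
  · set y : ℝ := Real.sqrt (p.imI ^ 2 + p.imJ ^ 2 + p.imK ^ 2) with hy
    have hy2 : y * y = p.imI ^ 2 + p.imJ ^ 2 + p.imK ^ 2 := Real.mul_self_sqrt (by positivity)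
    refine ⟨((⟨0, y⟩ : ℂ) : H) + p.im, ⟨p.re, y⟩, ?_, ?_⟩
    · intro h
      have h1 := congrArg (fun t : H => t.imJ) h
      have h2 := congrArg (fun t : H => t.imK) h
      simp only [Quaternion.imJ_add, Quaternion.imK_add, Quaternion.imJ_coeComplex,
        Quaternion.imK_coeComplex, Quaternion.imJ_im, Quaternion.imK_im, Quaternion.imJ_zero,
        Quaternion.imK_zero, zero_add] at h1 h2
      exact hp ⟨h1, h2⟩
    · apply Quaternion.ext <;> simp <;> nlinarith

lemma schwarzPick {E : Type*} [NormedAddCommGroup E] [NormedSpace ℂ E]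
    {ψ : ℂ → E} {K : ℝ} (hd : DifferentiableOn ℂ ψ (Metric.ball 0 1))
    (hb : ∀ z : ℂ, ‖z‖ < 1 → ‖ψ z‖ ≤ K) {r : ℝ} (hr1 : -1 < r) (hr2 : r < 1)
    (h0 : ψ r = 0) {z : ℂ} (hz : ‖z‖ < 1) :
    ‖ψ z‖ * ‖1 - (r : ℂ) * z‖ ≤ K * ‖z - r‖ := by
  have key : ∀ t : ℝ, -1 < t → t < 1 → ∀ w : ℂ, ‖w‖ < 1 → ‖w - t‖ < ‖1 - (t : ℂ) * w‖ := by
    intro t h1 h2 w hw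
    have e1 : ‖1 - (t : ℂ) * w‖ ^ 2 - ‖w - t‖ ^ 2 = (1 - t ^ 2) * (1 - ‖w‖ ^ 2) := by
      simp only [Complex.sq_norm, Complex.normSq_apply, Complex.sub_re, Complex.sub_im,
        Complex.mul_re, Complex.mul_im, Complex.ofReal_re, Complex.ofReal_im, Complex.one_re,
        Complex.one_im]
      ring
    have e2 : 0 < (1 - t ^ 2) * (1 - ‖w‖ ^ 2) := by
      apply mul_pos <;> nlinarith [norm_nonneg w]
    exact lt_of_pow_lt_pow_left₀ 2 (norm_nonneg _) (by linarith)
  have hne : ∀ t : ℝ, -1 < t → t < 1 → ∀ w : ℂ, ‖w‖ < 1 → 1 - (t : ℂ) * w ≠ 0 := by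
    intro t h1 h2 w hw h
    have := key t h1 h2 w hw
    rw [h, norm_zero] at this
    exact absurd this (not_lt.mpr (norm_nonneg _))
  have hmr : ∀ w : ℂ, ‖w‖ < 1 → 1 + (r : ℂ) * w ≠ 0 := by
    intro w hw
    have := hne (-r) (by linarith) (by linarith) w hw
    simpa using this
  set m : ℂ → ℂ := fun w => (w + r) / (1 + r * w) with hm
  have hmlt : ∀ w : ℂ, ‖w‖ < 1 → ‖m w‖ < 1 := by
    intro w hw
    have := key (-r) (by linarith) (by linarith) w hw
    rw [hm, norm_div, div_lt_one (norm_pos_iff.mpr (hmr w hw))]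
    simpa using this
  have hmd : DifferentiableOn ℂ m (Metric.ball 0 1) := by
    intro w hw
    have h1 := hmr w (by simpa using hw)
    apply DifferentiableAt.differentiableWithinAt
    fun_prop (disch := exact h1)
  have hcomp : DifferentiableOn ℂ (ψ ∘ m) (Metric.ball 0 1) :=
    hd.comp hmd (fun w hw => by simpa using hmlt w (by simpa using hw))
  have hc0 : (ψ ∘ m) 0 = 0 := by simp [hm, h0]
  set w : ℂ := (z - r) / (1 - r * z) with hw
  have hnz := hne r hr1 hr2 z hz
  have hwlt : ‖w‖ < 1 := by
    rw [hw, norm_div, div_lt_one (norm_pos_iff.mpr hnz)]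
    exact key r hr1 hr2 z hz
  have hmw : m w = z := by
    have h2 := hmr w hwlt
    have h3 : w * (1 - r * z) = z - r := div_mul_cancel₀ _ hnz
    rw [hm]
    simp only
    rw [div_eq_iff h2]
    linear_combination h3
  have := Complex.dist_le_div_mul_dist_of_mapsTo_ball (f := ψ ∘ m) (c := 0) (R₁ := 1) (R₂ := K)
    (z := w) hcomp (by
      intro x hx
      rw [hc0, mem_closedBall_zero_iff]
      exact hb _ (hmlt x (by simpa using hx))) (by simpa using hwlt)
  rw [hc0, dist_zero_right, dist_zero_right, Function.comp_apply, hmw, div_one, hw, norm_div,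
    ← mul_div_assoc, le_div_iff₀ (norm_pos_iff.mpr hnz)] at this
  exact this

lemma fwd_abs {E : Type*} [NormedAddCommGroup E] [NormedSpace ℂ E] [CompleteSpace E]
    (R : ℕ → E →L[ℂ] E)
    (hR : ∀ t : ℝ, 0 ≤ t → t < 1 → Summable fun n : ℕ => t ^ n * ‖R n‖)
    (S Sb : E →L[ℂ] E) (hSb : ‖Sb‖ < 1)
    (hΦ : ∀ z : ℂ, ‖z‖ < 1 → ∀ u : E, ‖∑' n : ℕ, z ^ n • R n u‖ ≤ ‖u‖)
    (hkey : ∀ u B : E, ‖B‖ ≤ ‖u‖ → ‖B - S u‖ ≤ ‖u - Sb B‖)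
    {r : ℝ} (hr1 : -1 < r) (hr2 : r < 1)
    (hr : ∀ u : E, ∑' n : ℕ, (r : ℂ) ^ n • R n u = S u)
    {z : ℂ} (hz : ‖z‖ < 1) (h B : E) (hB : ∑' n : ℕ, z ^ n • R n h = B) :
    ‖B - S h‖ * ‖1 - (r : ℂ) * z‖ ≤ ‖h - Sb B‖ * ‖z - r‖ := by
  set Φ : ℂ → E →L[ℂ] E := fun w => ∑' n : ℕ, w ^ n • R n with hΦd
  have hsum : ∀ w : ℂ, ‖w‖ < 1 → Summable fun n : ℕ => w ^ n • R n := by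
    intro w hw
    refine Summable.of_norm_bounded (hR ‖w‖ (norm_nonneg _) hw) (fun n => ?_)
    rw [norm_smul, norm_pow]
  have happ : ∀ w : ℂ, ‖w‖ < 1 → ∀ u : E, Φ w u = ∑' n : ℕ, w ^ n • R n u := by
    intro w hw u
    have := (hsum w hw).hasSum.mapL (ContinuousLinearMap.apply ℂ E u)
    have := this.tsum_eq
    simpa using this.symm
  have hdΦ : DifferentiableOn ℂ Φ (Metric.ball 0 1) := by
    intro w hw
    have hw1 : ‖w‖ < 1 := by simpa using hw
    obtain ⟨t, ht1, ht2⟩ := exists_between hw1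
    have ht0 : 0 ≤ t := (norm_nonneg w).trans ht1.le
    have := Complex.differentiableOn_tsum_of_summable_norm (F := fun (n : ℕ) (w : ℂ) => w ^ n • R n)
      (U := Metric.ball 0 t) (hR t ht0 ht2) (fun n => by fun_prop) Metric.isOpen_ball (by
        intro n v hv
        have hv1 : ‖v‖ < t := by simpa using hv
        rw [norm_smul, norm_pow]
        gcongr)
    exact (this.differentiableAt (Metric.isOpen_ball.mem_nhds
      (by simpa using ht1))).differentiableWithinAt
  have hΦn : ∀ w : ℂ, ‖w‖ < 1 → ‖Φ w‖ ≤ 1 := by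
    intro w hw
    refine ContinuousLinearMap.opNorm_le_bound _ zero_le_one (fun u => ?_)
    rw [happ w hw, one_mul]
    exact hΦ w hw u
  set G : ℂ → E →L[ℂ] E := fun w => 1 - Sb * Φ w with hG
  have hGu : ∀ w : ℂ, ‖w‖ < 1 → IsUnit (G w) := by
    intro w hw
    refine isUnit_one_sub_of_norm_lt_one ?_
    calc ‖Sb * Φ w‖ ≤ ‖Sb‖ * ‖Φ w‖ := norm_mul_le _ _
      _ ≤ ‖Sb‖ * 1 := by gcongr; exact hΦn w hw
      _ < 1 := by rwa [mul_one]
  have hGd : DifferentiableOn ℂ G (Metric.ball 0 1) :=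
    (differentiableOn_const _).sub ((differentiableOn_const _).mul hdΦ)
  have hGi : DifferentiableOn ℂ (fun w => Ring.inverse (G w)) (Metric.ball 0 1) :=
    hGd.inverse (fun w hw => hGu w (by simpa using hw))
  set k : E := G z h with hk
  have hkB : k = h - Sb B := by
    rw [hk, hG]
    simp [happ z hz, hB]
  set ψ : ℂ → E := fun w => (Φ w - S) (Ring.inverse (G w) k) with hψ
  have hψd : DifferentiableOn ℂ ψ (Metric.ball 0 1) :=
    (hdΦ.sub (differentiableOn_const _)).clm_apply (hGi.clm_apply (differentiableOn_const _))
  have hψb : ∀ w : ℂ, ‖w‖ < 1 → ‖ψ w‖ ≤ ‖k‖ := by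
    intro w hw
    set u := Ring.inverse (G w) k with hu
    have h1 : G w u = k := by
      rw [hu, ← mul_apply_eq_comp, Ring.mul_inverse_cancel _ (hGu w hw)]
      rfl
    have h2 := hkey u (Φ w u) (by rw [happ w hw]; exact hΦ w hw u)
    have h3 : ψ w = Φ w u - S u := rfl
    rw [h3, ← h1]
    exact h2
  have hψr : ψ r = 0 := by
    have hrn : ‖(r : ℂ)‖ < 1 := by
      rw [Complex.norm_real, Real.norm_eq_abs, abs_lt]; exact ⟨hr1, hr2⟩
    have : ∀ u, Φ r u = S u := fun u => by rw [happ _ hrn, hr]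
    simp [hψ, this]
  have hψz : ψ z = B - S h := by
    have h1 : Ring.inverse (G z) k = h := by
      rw [hk, ← mul_apply_eq_comp, Ring.inverse_mul_cancel _ (hGu z hz)]
      rfl
    simp [hψ, h1, happ z hz, hB]
  have := schwarzPick hψd hψb hr1 hr2 hψr hz
  rwa [hψz, hkB] at this

/-- The left complex structure on the quaternions. -/
@[reducible] def cAct : NormedSpace ℂ H :=
  letI : Module ℂ H := Module.compHom H (Quaternion.ofComplex : ℂ →ₐ[ℝ] H).toRingHom
  { norm_smul_le := fun z h => by
      show ‖(z : H) * h‖ ≤ _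
      rw [norm_mul, norm_coeComplex'] }

lemma cAct_smul (z : ℂ) (h : H) : letI := cAct; z • h = (z : H) * h := rfl

/-- Right multiplication as a complex linear map. -/
def rMul (c : H) : letI := cAct; H →L[ℂ] H :=
  letI := cAct
  LinearMap.mkContinuous
    { toFun := fun u => u * c
      map_add' := fun x y => add_mul x y c
      map_smul' := fun z x => by
        show (z : H) * x * c = (z : H) * (x * c)
        rw [mul_assoc] } ‖c‖ (fun u => by
        show ‖u * c‖ ≤ _
        rw [norm_mul, mul_comm])

lemma rMul_norm (c : H) : letI := cAct; ‖rMul c‖ ≤ ‖c‖ :=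
  letI := cAct
  LinearMap.mkContinuous_norm_le _ (norm_nonneg c) _

lemma coeComplex_pow' (z : ℂ) (n : ℕ) : ((z ^ n : ℂ) : H) = (z : H) ^ n :=
  map_pow Quaternion.ofComplex z n

lemma summable_norm_coeff {a : ℕ → H} (ha : SummableOn a) {t : ℝ} (ht0 : 0 ≤ t) (ht : t < 1) :
    Summable fun n : ℕ => t ^ n * ‖a n‖ := by
  obtain ⟨t', h1, h2⟩ := exists_between ht
  have ht' : 0 < t' := ht0.trans_lt h1
  have hs := ha (t' : H) (by rw [Quaternion.norm_coe, Real.norm_of_nonneg ht'.le]; exact h2)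
  have hb := (hs.tendsto_atTop_zero.norm.bddAbove_range)
  obtain ⟨C, hC⟩ := hb
  refine Summable.of_nonneg_of_le (f := fun n : ℕ => C * (t / t') ^ n) (fun n => by positivity)
    (fun n => ?_) ((summable_geometric_of_lt_one (by positivity)
      ((div_lt_one ht').mpr h1)).mul_left C)
  have h3 : t' ^ n * ‖a n‖ ≤ C := by
    have := hC ⟨n, rfl⟩
    simpa [norm_mul, norm_pow, Quaternion.norm_coe, abs_of_pos ht'] using this
  have h4 : t ^ n * ‖a n‖ = (t' ^ n * ‖a n‖) * (t / t') ^ n := by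
    rw [div_pow]; field_simp
  rw [h4]
  gcongr

lemma fwd {r : ℝ} (hr1 : -1 < r) (hr2 : r < 1)
    {p : H} (hp : ‖p‖ < 1) {s q : H} (hs : ‖s‖ < 1)
    {a : ℕ → H} (ha : SelfMap a) (has : evalC a (r : H) = s) (haq : evalC a p = q) :
    ‖q - s‖ * ‖1 - (r : H) * p‖ ≤ ‖1 - q * star s‖ * ‖p - (r : H)‖ := by
  letI := cAct
  obtain ⟨h, z, hh, hpz⟩ := exists_conj p
  have hh0 := norm_pos_iff.mpr hh
  -- conjugation formula
  have hconj : ∀ (u x : H) (w : ℂ), u * x = (w : H) * u →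
      ∑' n : ℕ, w ^ n • rMul (a n) u = u * evalC a x := by
    intro u x w hx
    rw [evalC, ← tsum_mul_left]
    refine tsum_congr (fun n => ?_)
    show ((w ^ n : ℂ) : H) * (u * a n) = _
    rw [coeComplex_pow', ← mul_assoc, ← mul_assoc]
    congr 1
    have : SemiconjBy u x (w : H) := hx
    exact (this.pow_right n).eq.symm
  have hzn : ‖z‖ = ‖p‖ := by
    have := congrArg norm hpz
    rw [norm_mul, norm_mul, norm_coeComplex', mul_comm] at this
    exact (mul_right_cancel₀ hh0.ne' this).symm
  have hΦ : ∀ w : ℂ, ‖w‖ < 1 → ∀ u : H, ‖∑' n : ℕ, w ^ n • rMul (a n) u‖ ≤ ‖u‖ := by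
    intro w hw u
    by_cases hu : u = 0
    · subst hu
      rw [hconj 0 0 w (by simp)]
      simp
    · rw [hconj u (u⁻¹ * w * u) w (by rw [mul_assoc, mul_inv_cancel_left₀ hu]), norm_mul]
      have : ‖u⁻¹ * (w : H) * u‖ < 1 := by
        rw [norm_mul, norm_mul, norm_inv, norm_coeComplex', mul_right_comm,
          inv_mul_cancel₀ (norm_pos_iff.mpr hu).ne', one_mul]
        exact hw
      have := ha.2 _ this
      nlinarith [norm_nonneg u]
  have hmain := fwd_abs (E := H) (fun n => rMul (a n))
    (fun t ht0 ht => Summable.of_nonneg_of_le (fun n => by positivity)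
      (fun n => mul_le_mul_of_nonneg_left (rMul_norm (a n)) (by positivity))
      (summable_norm_coeff ha.1 ht0 ht))
    (rMul s) (rMul (star s)) ((rMul_norm _).trans_lt (by rwa [norm_star])) hΦ
    (by
      intro u B hB
      show ‖B - u * s‖ ≤ ‖u - B * star s‖
      have h1 := key_normSq u B (-s)
      simp only [Quaternion.normSq_eq_norm_mul_self, norm_neg, star_neg, mul_neg,
        ← sub_eq_add_neg] at h1
      have h2 : 0 ≤ (1 - ‖s‖ * ‖s‖) * (‖u‖ * ‖u‖ - ‖B‖ * ‖B‖) := by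
        apply mul_nonneg <;> nlinarith [norm_nonneg s, norm_nonneg u, norm_nonneg B]
      nlinarith [norm_nonneg (B - u * s), norm_nonneg (u - B * star s)])
    hr1 hr2
    (by
      intro u
      rw [hconj u (r : H) r (by rw [Quaternion.coeComplex_coe, Quaternion.coe_commutes]), has]
      rfl)
    (hzn.trans_lt hp) h (h * q) (by rw [hconj h p z hpz, haq])
  have e1 : h * q - rMul s h = h * (q - s) := (mul_sub h q s).symm
  have e2 : h - rMul (star s) (h * q) = h * (1 - q * star s) := by
    rw [mul_sub, mul_one, ← mul_assoc]; rfl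
  have e3 : ‖1 - (r : ℂ) * z‖ = ‖1 - (r : H) * p‖ := by
    have h1 : h * (1 - (r : H) * p) = ((1 - (r : ℂ) * z : ℂ) : H) * h := by
      have : ((1 - (r : ℂ) * z : ℂ) : H) = 1 - (r : H) * (z : H) := by
        apply Quaternion.ext <;>
          simp [Quaternion.re_one, Quaternion.imI_one, Quaternion.imJ_one, Quaternion.imK_one]
      rw [this, mul_sub, sub_mul, mul_one, one_mul, ← mul_assoc, ← Quaternion.coe_commutes r h,
        mul_assoc, hpz, mul_assoc]
    have := congrArg norm h1
    rw [norm_mul, norm_mul, norm_coeComplex', mul_comm] at this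
    exact (mul_right_cancel₀ hh0.ne' this).symm
  have e4 : ‖z - (r : ℂ)‖ = ‖p - (r : H)‖ := by
    have h1 : h * (p - (r : H)) = ((z - (r : ℂ) : ℂ) : H) * h := by
      have : ((z - (r : ℂ) : ℂ) : H) = (z : H) - (r : H) := by
        apply Quaternion.ext <;>
          simp [Quaternion.re_one, Quaternion.imI_one, Quaternion.imJ_one, Quaternion.imK_one]
      rw [this, mul_sub, sub_mul, hpz, Quaternion.coe_commutes r h]
    have := congrArg norm h1
    rw [norm_mul, norm_mul, norm_coeComplex', mul_comm] at this
    exact (mul_right_cancel₀ hh0.ne' this).symm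
  rw [e1, e2, e3, e4, norm_mul, norm_mul, mul_assoc, mul_assoc] at hmain
  exact le_of_mul_le_mul_left hmain hh0

/-- Two-point Nevanlinna–Pick interpolation with a real node: there exists a
slice regular self-map `f` of `𝔹` with `f(r) = s` and `f(p) = q` iff
`ρ(q,s) ≤ ρ(p,r)`. -/
theorem nevanlinnaPick_two_points (r : ℝ) (hr1 : -1 < r) (hr2 : r < 1)
    (p : H) (hp : ‖p‖ < 1) (hpr : p ≠ (r : H)) (s q : H) (hs : ‖s‖ < 1) (hq : ‖q‖ < 1) :
    (∃ a : ℕ → H, SelfMap a ∧ evalC a (r : H) = s ∧ evalC a p = q) ↔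
      rho q s ≤ rho p (r : H) := by
  have hm := mob_lt hr1 hr2 hp
  have h3 : 0 < ‖1 - (r : H) * p‖ := (norm_nonneg _).trans_lt hm
  have h1 : 1 - q * star s ≠ 0 := by
    intro h0
    have : ‖q * star s‖ = 1 := by rw [← sub_eq_zero.mp h0, norm_one]
    rw [norm_mul, norm_star] at this
    nlinarith [norm_nonneg q, norm_nonneg s]
  have e1 : ‖1 - s * star q‖ = ‖1 - q * star s‖ := by
    rw [← norm_star, star_sub, star_mul, star_star, star_one]
  have e2 : ‖1 - (r : H) * star p‖ = ‖1 - (r : H) * p‖ := by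
    rw [← norm_star, star_sub, star_mul, star_star, star_one, Quaternion.star_coe,
      Quaternion.coe_commutes]
  have key : rho q s ≤ rho p (r : H) ↔
      ‖q - s‖ * ‖1 - (r : H) * p‖ ≤ ‖1 - q * star s‖ * ‖p - (r : H)‖ := by
    unfold rho mobiusM
    rw [norm_mul, norm_mul, norm_inv, norm_inv, e1, e2, norm_sub_rev s q, norm_sub_rev _ p,
      inv_mul_le_iff₀ (norm_pos_iff.mpr h1), mul_left_comm, ← div_eq_inv_mul, le_div_iff₀ h3]
  rw [key]
  constructor
  · rintro ⟨a, ha, has, haq⟩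
    exact fwd hr1 hr2 hp hs ha has haq
  · exact back hr1 hr2 hp hpr hs hq

end QPaper
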